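/- Let f be a one-hidden-layer neural network with 3D input. If aᵢ aⱼ (W_{i3} W_{j2} − W_{i2} W_{j3}) = 0 for all i, j ∈ {1, …, d₁}, then there exist α, β ∈ ℝ and a function g : ℝ² → ℝ such that f(x, y, z) = g(x, α y + β z) for all (x, y, z) ∈ ℝ³; in particular f(x, y, z) = f(x, y', z') whenever α y + β z = α y' + β z', so for every fixed x the slice of the decision boundary {p ∈ ℝ³ : f(p) = 0} in the plane {x} × ℝ² is a union of lines with common normal (α, β) (whenever (α, β) ≠ 0). -/

import Mathlib

/-- If the planar vectors `(u i, v i)` with `a i ≠ 0` are pairwise parallel, then they are all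
multiples of a single vector `(α, β)`. -/
theorem exists_common_direction {ι : Type*} (a u v : ι → ℝ)
    (h : ∀ i j, a i * a j * (v i * u j - u i * v j) = 0) :
    ∃ (α β : ℝ) (t : ι → ℝ), ∀ j, a j ≠ 0 → u j = t j * α ∧ v j = t j * β := by
  by_cases hex : ∃ i, a i ≠ 0 ∧ (u i ≠ 0 ∨ v i ≠ 0)
  · obtain ⟨i, hai, hi⟩ := hex
    have hpar : ∀ j, a j ≠ 0 → v i * u j = u i * v j := fun j hj =>
      sub_eq_zero.mp ((mul_eq_zero.mp (h i j)).resolve_left (mul_ne_zero hai hj))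
    rcases hi with hu | hv
    · refine ⟨u i, v i, fun j => u j / u i, fun j hj => ⟨by field_simp, ?_⟩⟩
      field_simp
      linarith [hpar j hj]
    · refine ⟨u i, v i, fun j => v j / v i, fun j hj => ⟨?_, by field_simp⟩⟩
      field_simp
      linarith [hpar j hj]
  · push Not at hex
    exact ⟨0, 0, 0, fun j hj => by simpa using hex j hj⟩

/-- If `aᵢ aⱼ (W_{i3} W_{j2} − W_{i2} W_{j3}) = 0` for all `i, j`, a one-hidden-layer network
with 3D input is a function of `x` and a single linear form `α y + β z`; in particular, for
fixed `x` its value is constant on each line `α y + β z = const`, so each slice of the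
decision boundary is a union of lines with common normal `(α, β)`. -/
theorem statement11 (d₁ : ℕ) (a : Fin d₁ → ℝ) (W : Fin d₁ → Fin 3 → ℝ) (b : Fin d₁ → ℝ)
    (c : ℝ) (σ : ℝ → ℝ) (hσ : ContDiff ℝ 2 σ) (f : ℝ → ℝ → ℝ → ℝ)
    (hf : ∀ x y z, f x y z = (∑ i, a i * σ (W i 0 * x + W i 1 * y + W i 2 * z + b i)) + c)
    (hW : ∀ i j, a i * a j * (W i 2 * W j 1 - W i 1 * W j 2) = 0) :
    ∃ (α β : ℝ) (g : ℝ → ℝ → ℝ),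
      (∀ x y z : ℝ, f x y z = g x (α * y + β * z)) ∧
      (∀ x y z y' z' : ℝ, α * y + β * z = α * y' + β * z' → f x y z = f x y' z') := by
  obtain ⟨α, β, t, ht⟩ := exists_common_direction a (fun i => W i 1) (fun i => W i 2) hW
  have key : ∀ x y z, f x y z =
      (∑ i, a i * σ (W i 0 * x + t i * (α * y + β * z) + b i)) + c := by
    intro x y z
    rw [hf]
    congr 1
    refine Finset.sum_congr rfl fun i _ => ?_
    by_cases hi : a i = 0
    · simp [hi]
    · obtain ⟨h1, h2⟩ := ht i hi
      rw [h1, h2]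
      ring_nf
  refine ⟨α, β, fun x s => (∑ i, a i * σ (W i 0 * x + t i * s + b i)) + c, key, ?_⟩
  intro x y z y' z' h
  rw [key, key, h]
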